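/- Reduction of strong constraint k-modules is compatible with the strong tensor product: for strong constraint k-modules E and F over a field k, there is a natural isomorphism (E ⊠ F)_red ≅ E_red ⊗_k F_red, where (E⊠F)_T = E_T ⊗ F_T, (E⊠F)_W = E_W ⊗ F_W + E_N ⊗ E_T-side terms, precisely (E⊠F)_W = E_W ⊗ F_W + E_N ⊗ F_T + E_T ⊗ F_N and (E⊠F)_N = E_N ⊗ F_T + E_T ⊗ F_N. -/

import Mathlib

open TensorProduct

section

variable {k : Type*} [Field k]
variable {E F : Type*} [AddCommGroup E] [AddCommGroup F] [Module k E] [Module k F]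

/-- The W-component `E_W ⊗ F_W + E_N ⊗ F_T + E_T ⊗ F_N` of the strong tensor
product of two strong constraint `k`-modules, inside `E_T ⊗ F_T`. -/
def strTensorW (EW EN : Submodule k E) (FW FN : Submodule k F) :
    Submodule k (E ⊗[k] F) :=
  LinearMap.range (TensorProduct.map EW.subtype FW.subtype)
    ⊔ LinearMap.range (TensorProduct.map EN.subtype (LinearMap.id : F →ₗ[k] F))
    ⊔ LinearMap.range (TensorProduct.map (LinearMap.id : E →ₗ[k] E) FN.subtype)

/-- The N-component `E_N ⊗ F_T + E_T ⊗ F_N` of the strong tensor product of two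
strong constraint `k`-modules, inside `E_T ⊗ F_T`. -/
def strTensorN (EN : Submodule k E) (FN : Submodule k F) :
    Submodule k (E ⊗[k] F) :=
  LinearMap.range (TensorProduct.map EN.subtype (LinearMap.id : F →ₗ[k] F))
    ⊔ LinearMap.range (TensorProduct.map (LinearMap.id : E →ₗ[k] E) FN.subtype)

/-- Reduction of strong constraint `k`-modules is compatible with the strong
tensor product: `(E ⊠ F)_red ≅ E_red ⊗_k F_red`, where
`(E⊠F)_W = E_W ⊗ F_W + E_N ⊗ F_T + E_T ⊗ F_N`,
`(E⊠F)_N = E_N ⊗ F_T + E_T ⊗ F_N`, and `X_red = X_W / X_N`. -/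
theorem constraint_strtensor_red
    (EW EN : Submodule k E) (hE : EN ≤ EW)
    (FW FN : Submodule k F) (hF : FN ≤ FW) :
    Nonempty
      ((strTensorW EW EN FW FN ⧸
          ((strTensorN EN FN).comap (strTensorW EW EN FW FN).subtype))
        ≃ₗ[k] ((EW ⧸ EN.comap EW.subtype) ⊗[k] (FW ⧸ FN.comap FW.subtype))) := by
  have hN : LinearMap.ker (TensorProduct.map EN.mkQ FN.mkQ) = strTensorN EN FN := by
    rw [TensorProduct.map_ker (LinearMap.exact_subtype_mkQ EN) (Submodule.mkQ_surjective _)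
      (LinearMap.exact_subtype_mkQ FN) (Submodule.mkQ_surjective _), sup_comm]
    rfl
  let p := TensorProduct.map EN.mkQ FN.mkQ
  let i := Submodule.mapQ (EN.comap EW.subtype) EN EW.subtype le_rfl
  let j := Submodule.mapQ (FN.comap FW.subtype) FN FW.subtype le_rfl
  have hi : Function.Injective i := by
    rw [← LinearMap.ker_eq_bot, Submodule.ker_mapQ, Submodule.mkQ_map_self]
  have hj : Function.Injective j := by
    rw [← LinearMap.ker_eq_bot, Submodule.ker_mapQ, Submodule.mkQ_map_self]
  have hij : Function.Injective (TensorProduct.map i j) :=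
    TensorProduct.map_injective_of_flat_flat i j hi hj
  have hker : (strTensorN EN FN).comap (strTensorW EW EN FW FN).subtype
      = LinearMap.ker (p ∘ₗ (strTensorW EW EN FW FN).subtype) := by
    rw [LinearMap.ker_comp, hN]
  have hWN : strTensorW EW EN FW FN =
      LinearMap.range (TensorProduct.map EW.subtype FW.subtype) ⊔ strTensorN EN FN := by
    rw [strTensorW, strTensorN, sup_assoc]
  have hpN : (strTensorN EN FN).map p = ⊥ := by
    rw [← hN, ← LinearMap.le_ker_iff_map]
  have hcomp : p ∘ₗ TensorProduct.map EW.subtype FW.subtype =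
      TensorProduct.map i j ∘ₗ
        TensorProduct.map (EN.comap EW.subtype).mkQ (FN.comap FW.subtype).mkQ := by
    rw [← TensorProduct.map_comp, ← TensorProduct.map_comp]
    rfl
  have hrange : LinearMap.range (p ∘ₗ (strTensorW EW EN FW FN).subtype)
      = LinearMap.range (TensorProduct.map i j) := by
    rw [LinearMap.range_comp, Submodule.range_subtype, hWN, Submodule.map_sup, hpN, sup_bot_eq,
      ← LinearMap.range_comp, hcomp, LinearMap.range_comp_of_range_eq_top]
    exact LinearMap.range_eq_top.2 (TensorProduct.map_surjective
      (Submodule.mkQ_surjective _) (Submodule.mkQ_surjective _))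
  exact ⟨(Submodule.quotEquivOfEq _ _ hker).trans
    ((LinearMap.quotKerEquivRange _).trans
      ((LinearEquiv.ofEq _ _ hrange).trans (LinearEquiv.ofInjective _ hij).symm))⟩

end
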